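/- arXiv:1407.7974 — 8 statements merged into one kernel-verified Lean document; each statement's English description precedes it below -/
import Mathlib

section
/- Let p, q : ℝ × ℝ → ℂ be functions of (x,t) that are twice continuously differentiable. For λ ∈ ℂ define the 2×2 matrices U(λ;x,t) = λ·[[−i,0],[0,i]] + [[0, i p],[−i q, 0]] and V(λ;x,t) = 2λ·U(λ;x,t) + [[−i p q, −∂_x p],[−∂_x q, i p q]]. Then the zero-curvature (compatibility) equation ∂_t U(λ;x,t) − ∂_x V(λ;x,t) + U(λ;x,t)·V(λ;x,t) − V(λ;x,t)·U(λ;x,t) = 0 holds for all λ ∈ ℂ and all (x,t) ∈ ℝ² if and only if (p,q) satisfies the coupled nonlinear Schrödinger system i ∂_t p + ∂_x² p − 2 p² q = 0 and i ∂_t q − ∂_x² q + 2 p q² = 0 on ℝ². -/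
open Complex Matrix

/-- Partial derivative with respect to the first variable `x`. -/
noncomputable def pderivX (f : ℝ × ℝ → ℂ) (z : ℝ × ℝ) : ℂ :=
  deriv (fun x => f (x, z.2)) z.1

/-- Partial derivative with respect to the second variable `t`. -/
noncomputable def pderivT (f : ℝ × ℝ → ℂ) (z : ℝ × ℝ) : ℂ :=
  deriv (fun t => f (z.1, t)) z.2

/-- The matrix `U(λ; x,t)` of the Lax pair. -/
noncomputable def Umat (p q : ℝ × ℝ → ℂ) (l : ℂ) (z : ℝ × ℝ) : Matrix (Fin 2) (Fin 2) ℂ :=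
  l • !![-I, 0; 0, I] + !![0, I * p z; -I * q z, 0]

/-- The matrix `V(λ; x,t)` of the Lax pair. -/
noncomputable def Vmat (p q : ℝ × ℝ → ℂ) (l : ℂ) (z : ℝ × ℝ) : Matrix (Fin 2) (Fin 2) ℂ :=
  (2 * l) • Umat p q l z +
    !![-I * p z * q z, -(pderivX p z); -(pderivX q z), I * p z * q z]

theorem hasDerivAt_pderivX {f : ℝ × ℝ → ℂ} (hf : Differentiable ℝ f) (z : ℝ × ℝ) :
    HasDerivAt (fun x => f (x, z.2)) (pderivX f z) z.1 :=
  DifferentiableAt.hasDerivAt (by fun_prop)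

theorem hasDerivAt_pderivX_pderivX {f : ℝ × ℝ → ℂ} (hf : ContDiff ℝ 2 f) (z : ℝ × ℝ) :
    HasDerivAt (fun x => pderivX f (x, z.2)) (pderivX (pderivX f) z) z.1 := by
  have hslice : ContDiff ℝ 2 (fun x : ℝ => f (x, z.2)) := by fun_prop
  have hderiv : Differentiable ℝ (deriv fun x : ℝ => f (x, z.2)) :=
    (hslice.iterate_deriv' 1 1).differentiable one_ne_zero
  exact (hderiv z.1).hasDerivAt

theorem pderivT_Umat (p q : ℝ × ℝ → ℂ) (l : ℂ) (z : ℝ × ℝ) :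
    (Matrix.of fun i j => pderivT (fun w => Umat p q l w i j) z)
      = !![0, I * pderivT p z; -I * pderivT q z, 0] := by
  ext i j
  fin_cases i <;> fin_cases j <;> simp [pderivT, Umat]

theorem pderivX_Vmat {p q : ℝ × ℝ → ℂ} (hp : ContDiff ℝ 2 p) (hq : ContDiff ℝ 2 q)
    (l : ℂ) (z : ℝ × ℝ) :
    (Matrix.of fun i j => pderivX (fun w => Vmat p q l w i j) z)
      = !![-I * (pderivX p z * q z + p z * pderivX q z),
            2 * l * (I * pderivX p z) - pderivX (pderivX p) z;
          2 * l * (-I * pderivX q z) - pderivX (pderivX q) z,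
            I * (pderivX p z * q z + p z * pderivX q z)] := by
  have hpx := hasDerivAt_pderivX (hp.differentiable two_ne_zero) z
  have hqx := hasDerivAt_pderivX (hq.differentiable two_ne_zero) z
  have hpxx := hasDerivAt_pderivX_pderivX hp z
  have hqxx := hasDerivAt_pderivX_pderivX hq z
  have hpq := hpx.mul hqx
  ext i j
  fin_cases i <;> fin_cases j <;> refine HasDerivAt.deriv ?_
  · convert (hpq.const_mul (-I)).const_add (2 * l * (l * -I)) using 1
    · ext x
      simp [Vmat, Umat, mul_assoc]
    · rfl
  · convert ((hpx.const_mul I).const_mul (2 * l)).sub hpxx using 1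
    · ext x
      simp [Vmat, Umat, sub_eq_add_neg]
    · rfl
  · convert ((hqx.const_mul (-I)).const_mul (2 * l)).sub hqxx using 1
    · ext x
      simp [Vmat, Umat, sub_eq_add_neg]
    · rfl
  · convert (hpq.const_mul I).const_add (2 * l * (l * I)) using 1
    · ext x
      simp [Vmat, Umat, mul_assoc]
    · rfl

/-- The zero-curvature expression is off-diagonal and independent of the spectral parameter. -/
theorem zero_curvature_eq {p q : ℝ × ℝ → ℂ} (hp : ContDiff ℝ 2 p) (hq : ContDiff ℝ 2 q)
    (l : ℂ) (z : ℝ × ℝ) :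
    (Matrix.of fun i j => pderivT (fun w => Umat p q l w i j) z)
        - (Matrix.of fun i j => pderivX (fun w => Vmat p q l w i j) z)
        + Umat p q l z * Vmat p q l z - Vmat p q l z * Umat p q l z
      = !![0, I * pderivT p z + pderivX (pderivX p) z - 2 * p z ^ 2 * q z;
          -(I * pderivT q z - pderivX (pderivX q) z + 2 * p z * q z ^ 2), 0] := by
  rw [pderivT_Umat, pderivX_Vmat hp hq]
  have hI : I ^ 2 = -1 := I_sq
  ext i j
  fin_cases i <;> fin_cases j <;>
    simp [Umat, Vmat] <;> grind

/-- The zero-curvature equation `∂ₜU − ∂ₓV + U·V − V·U = 0` holds for all `λ` and all `(x,t)`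
iff `(p,q)` satisfies the coupled nonlinear Schrödinger system. -/
theorem zero_curvature_iff_cNLS (p q : ℝ × ℝ → ℂ)
    (hp : ContDiff ℝ 2 p) (hq : ContDiff ℝ 2 q) :
    (∀ (l : ℂ) (z : ℝ × ℝ),
        (Matrix.of fun i j => pderivT (fun w => Umat p q l w i j) z)
          - (Matrix.of fun i j => pderivX (fun w => Vmat p q l w i j) z)
          + Umat p q l z * Vmat p q l z - Vmat p q l z * Umat p q l z = 0)
      ↔ (∀ z : ℝ × ℝ,
          I * pderivT p z + pderivX (pderivX p) z - 2 * p z ^ 2 * q z = 0 ∧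
          I * pderivT q z - pderivX (pderivX q) z + 2 * p z * q z ^ 2 = 0) := by
  simp only [zero_curvature_eq hp hq]
  constructor
  · intro h z
    have h01 := congrFun₂ (h 0 z) 0 1
    have h10 := congrFun₂ (h 0 z) 1 0
    exact ⟨h01, neg_eq_zero.mp h10⟩
  · intro h l z
    obtain ⟨hpz, hqz⟩ := h z
    ext i j
    fin_cases i <;> fin_cases j <;> simp [hpz, hqz]
end

section
/- Let b₋, b₊ > 0 be real and let B be the complex 2×2 matrix B = [[i b₋/2, −1/2],[−1/2, i b₊/2]]. For u = (u₁,u₂) ∈ ℂ², the two-dimensional Riemann theta series Θ(u|B) = ∑_{(m₁,m₂) ∈ ℤ²} exp(π i (m₁² · i b₋/2 − m₁ m₂ + m₂² · i b₊/2) + 2π i (m₁ u₁ + m₂ u₂)) converges absolutely and equals θ₃(2u₁|2i b₋)·θ₃(2u₂|2i b₊) + θ₂(2u₁|2i b₋)·θ₃(2u₂|2i b₊) + θ₃(2u₁|2i b₋)·θ₂(2u₂|2i b₊) − θ₂(2u₁|2i b₋)·θ₂(2u₂|2i b₊). -/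
open Complex

/-- Jacobi elliptic theta function `θ₃(u|τ)`. -/
noncomputable def theta3 (u τ : ℂ) : ℂ :=
  ∑' m : ℤ, Complex.exp (Real.pi * I * (m : ℂ) ^ 2 * τ + 2 * Real.pi * I * (m : ℂ) * u)

/-- Jacobi elliptic theta function `θ₂(u|τ)`. -/
noncomputable def theta2 (u τ : ℂ) : ℂ :=
  ∑' m : ℤ, Complex.exp (Real.pi * I * ((m : ℂ) + 1 / 2) ^ 2 * τ
    + 2 * Real.pi * I * ((m : ℂ) + 1 / 2) * u)

/-- The combination of products of Jacobi theta functions appearing in the two-phase solution. -/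
noncomputable def H (bm bp : ℝ) (u₁ u₂ : ℂ) : ℂ :=
  theta3 u₁ (2 * I * bm) * theta3 u₂ (2 * I * bp)
    + theta2 u₁ (2 * I * bm) * theta3 u₂ (2 * I * bp)
    + theta3 u₁ (2 * I * bm) * theta2 u₂ (2 * I * bp)
    - theta2 u₁ (2 * I * bm) * theta2 u₂ (2 * I * bp)

theorem HasSum.int_even_add_odd {f : ℤ → ℂ} {a b : ℂ} (he : HasSum (fun k => f (2 * k)) a)
    (ho : HasSum (fun k => f (2 * k + 1)) b) : HasSum f (a + b) := by
  have hinj := mul_right_injective₀ (two_ne_zero' ℤ)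
  replace ho := ((add_left_injective 1).comp hinj).hasSum_range_iff.2 ho
  refine (hinj.hasSum_range_iff.2 he).add_isCompl ?_ ho
  have heven : Set.range (fun k : ℤ => 2 * k) = {n | Even n} := by
    ext n
    simp [even_iff_exists_two_mul]
  have hodd : Set.range ((fun k : ℤ => k + 1) ∘ fun k : ℤ => 2 * k) = {n | Odd n} := by
    ext n
    simp [Odd, eq_comm]
  rw [heven, hodd]
  exact Int.isCompl_even_odd

/-- The series `∑ exp(π i m² τ + 2 π i m u)` split by parity, with the even terms and the odd terms
resummed as `θ₃(2u|4τ)` and `θ₂(2u|4τ)`, the odd terms weighted by a sign `s`. -/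
theorem hasSum_sign_mul_jacobiTheta₂_term {τ : ℂ} (hτ : 0 < τ.im) (u s : ℂ) :
    HasSum (fun m : ℤ => (if Even m then 1 else s) * jacobiTheta₂_term m u τ)
      (theta3 (2 * u) (4 * τ) + s * theta2 (2 * u) (4 * τ)) := by
  have hsum : Summable (jacobiTheta₂_term · u τ) := (summable_jacobiTheta₂_term_iff u τ).2 hτ
  apply HasSum.int_even_add_odd
  · have h := (hsum.comp_injective (mul_right_injective₀ (two_ne_zero' ℤ))).hasSum
    convert h using 1
    · rfl
    · funext m
      simp
    · refine tsum_congr fun m => ?_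
      simp only [Function.comp_apply, jacobiTheta₂_term]
      congr 1
      push_cast
      ring
  · have hinj : Function.Injective fun m : ℤ => 2 * m + 1 := fun a b h => by
      simpa using h
    have h := ((hsum.comp_injective hinj).hasSum).mul_left s
    convert h using 1
    · rfl
    · funext m
      simp
    · congr 1
      refine tsum_congr fun m => ?_
      simp only [Function.comp_apply, jacobiTheta₂_term]
      congr 1
      push_cast
      ring

theorem HasSum.mul_of_complex {ι κ : Type*} {f : ι → ℂ} {g : κ → ℂ} {a b : ℂ} (hf : HasSum f a)
    (hg : HasSum g b) : HasSum (fun x : ι × κ => f x.1 * g x.2) (a * b) := by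
  have hfg : Summable fun x : ι × κ => f x.1 * g x.2 := by
    apply summable_mul_of_summable_norm hf.summable.norm hg.summable.norm
  exact hf.mul hg hfg

theorem exp_neg_pi_mul_I_mul_int_mul_int (m n : ℤ) :
    Complex.exp (-(Real.pi * I * ((m : ℂ) * (n : ℂ)))) =
      ((if Even m then 1 else 1) * (if Even n then 1 else 1)
        + (if Even m then 1 else -1) * (if Even n then 1 else 1)
        + (if Even m then 1 else 1) * (if Even n then 1 else -1)
        - (if Even m then 1 else -1) * (if Even n then 1 else -1)) / 2 := by
  have h : Complex.exp (-(Real.pi * I * ((m : ℂ) * (n : ℂ)))) = (-1) ^ (-(m * n)) := by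
    rw [← Complex.exp_pi_mul_I, ← Complex.exp_int_mul]
    congr 1
    push_cast
    ring
  rw [h, zpow_neg]
  by_cases hm : Even m <;> by_cases hn : Even n
  · rw [(hm.mul_right n).neg_one_zpow]; norm_num [hm, hn]
  · rw [(hm.mul_right n).neg_one_zpow]; norm_num [hm, hn]
  · rw [(hn.mul_left m).neg_one_zpow]; norm_num [hm, hn]
  · rw [((Int.not_even_iff_odd.1 hm).mul (Int.not_even_iff_odd.1 hn)).neg_one_zpow]
    norm_num [hm, hn]

/-- The two-dimensional Riemann theta series with period matrix
`B = [[i b₋/2, −1/2],[−1/2, i b₊/2]]` converges absolutely and decomposes into products of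
Jacobi elliptic theta functions. -/
theorem riemann_theta_decomposition (bm bp : ℝ) (hbm : 0 < bm) (hbp : 0 < bp) (u₁ u₂ : ℂ) :
    Summable (fun m : ℤ × ℤ => Complex.exp
        (Real.pi * I * ((m.1 : ℂ) ^ 2 * (I * bm / 2) - (m.1 : ℂ) * (m.2 : ℂ)
            + (m.2 : ℂ) ^ 2 * (I * bp / 2))
          + 2 * Real.pi * I * ((m.1 : ℂ) * u₁ + (m.2 : ℂ) * u₂))) ∧
    (∑' m : ℤ × ℤ, Complex.exp
        (Real.pi * I * ((m.1 : ℂ) ^ 2 * (I * bm / 2) - (m.1 : ℂ) * (m.2 : ℂ)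
            + (m.2 : ℂ) ^ 2 * (I * bp / 2))
          + 2 * Real.pi * I * ((m.1 : ℂ) * u₁ + (m.2 : ℂ) * u₂)))
      = theta3 (2 * u₁) (2 * I * bm) * theta3 (2 * u₂) (2 * I * bp)
        + theta2 (2 * u₁) (2 * I * bm) * theta3 (2 * u₂) (2 * I * bp)
        + theta3 (2 * u₁) (2 * I * bm) * theta2 (2 * u₂) (2 * I * bp)
        - theta2 (2 * u₁) (2 * I * bm) * theta2 (2 * u₂) (2 * I * bp) := by
  have hτ (b : ℝ) (hb : 0 < b) : 0 < (I * b / 2 : ℂ).im := by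
    simpa using hb
  have h (s t : ℂ) :=
    (hasSum_sign_mul_jacobiTheta₂_term (hτ bm hbm) u₁ s).mul_of_complex
      (hasSum_sign_mul_jacobiTheta₂_term (hτ bp hbp) u₂ t)
  have key := ((((h 1 1).add (h (-1) 1)).add (h 1 (-1))).sub (h (-1) (-1))).div_const 2
  have hb (b : ℝ) : 4 * (I * b / 2 : ℂ) = 2 * I * b := by ring
  simp only [hb] at key
  suffices hs : HasSum (fun m : ℤ × ℤ => Complex.exp
      (Real.pi * I * ((m.1 : ℂ) ^ 2 * (I * bm / 2) - (m.1 : ℂ) * (m.2 : ℂ)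
          + (m.2 : ℂ) ^ 2 * (I * bp / 2))
        + 2 * Real.pi * I * ((m.1 : ℂ) * u₁ + (m.2 : ℂ) * u₂))) _ from
    ⟨hs.summable, hs.tsum_eq⟩
  have hexp (m : ℤ × ℤ) : Complex.exp
      (Real.pi * I * ((m.1 : ℂ) ^ 2 * (I * bm / 2) - (m.1 : ℂ) * (m.2 : ℂ)
          + (m.2 : ℂ) ^ 2 * (I * bp / 2))
        + 2 * Real.pi * I * ((m.1 : ℂ) * u₁ + (m.2 : ℂ) * u₂)) =
      Complex.exp (-(Real.pi * I * ((m.1 : ℂ) * (m.2 : ℂ)))) *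
        (jacobiTheta₂_term m.1 u₁ (I * bm / 2) * jacobiTheta₂_term m.2 u₂ (I * bp / 2)) := by
    simp only [jacobiTheta₂_term, ← Complex.exp_add]
    congr 1
    ring
  convert key using 1
  · rfl
  · funext m
    rw [hexp m, exp_neg_pi_mul_I_mul_int_mul_int]
    ring
  · ring
end

section
/- Let b₋, b₊ > 0 be real. Then for all u₁, u₂ ∈ ℂ, the half-imaginary-period identities H(u₁ + i b₋, u₂) = exp(π b₋/2 − π i u₁) · H(u₁, u₂ + 1) and H(u₁, u₂ + i b₊) = exp(π b₊/2 − π i u₂) · H(u₁ + 1, u₂) hold. -/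
open Complex

theorem theta3_add_one (u τ : ℂ) : theta3 (u + 1) τ = theta3 u τ := by
  refine tsum_congr fun m => Complex.exp_eq_exp_iff_exists_int.mpr ⟨m, by ring⟩

theorem theta2_add_one (u τ : ℂ) : theta2 (u + 1) τ = -theta2 u τ := by
  rw [theta2, theta2, ← tsum_neg]
  refine tsum_congr fun m => ?_
  rw [← mul_neg_one, ← Complex.exp_pi_mul_I, ← Complex.exp_add]
  exact Complex.exp_eq_exp_iff_exists_int.mpr ⟨m, by ring⟩

theorem theta3_add_half_period (u τ : ℂ) :
    theta3 (u + τ / 2) τ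
      = Complex.exp (-(Real.pi * I * τ / 4) - Real.pi * I * u) * theta2 u τ := by
  rw [theta3, theta2, ← tsum_mul_left]
  refine tsum_congr fun m => ?_
  rw [← Complex.exp_add]
  ring_nf

theorem theta2_add_half_period (u τ : ℂ) :
    theta2 (u + τ / 2) τ
      = Complex.exp (-(Real.pi * I * τ / 4) - Real.pi * I * u) * theta3 u τ := by
  rw [theta3, theta2, ← tsum_mul_left, ← (Equiv.subRight (1 : ℤ)).tsum_eq]
  refine tsum_congr fun m => ?_
  rw [Equiv.subRight_apply, ← Complex.exp_add]
  push_cast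
  ring_nf

theorem theta3_add_I_mul (b : ℝ) (u : ℂ) :
    theta3 (u + I * b) (2 * I * b)
      = Complex.exp (Real.pi * b / 2 - Real.pi * I * u) * theta2 u (2 * I * b) := by
  convert theta3_add_half_period u (2 * I * b) using 3
  · ring
  · linear_combination (Real.pi * b / 2 : ℂ) * I_mul_I

theorem theta2_add_I_mul (b : ℝ) (u : ℂ) :
    theta2 (u + I * b) (2 * I * b)
      = Complex.exp (Real.pi * b / 2 - Real.pi * I * u) * theta3 u (2 * I * b) := by
  convert theta2_add_half_period u (2 * I * b) using 3
  · ring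
  · linear_combination (Real.pi * b / 2 : ℂ) * I_mul_I

/-- Half-imaginary-period identities for `H`. -/
theorem H_half_period (bm bp : ℝ) (hbm : 0 < bm) (hbp : 0 < bp) (u₁ u₂ : ℂ) :
    H bm bp (u₁ + I * bm) u₂
        = Complex.exp (Real.pi * bm / 2 - Real.pi * I * u₁) * H bm bp u₁ (u₂ + 1) ∧
    H bm bp u₁ (u₂ + I * bp)
        = Complex.exp (Real.pi * bp / 2 - Real.pi * I * u₂) * H bm bp (u₁ + 1) u₂ := by
  simp only [H, theta3_add_I_mul, theta2_add_I_mul, theta3_add_one, theta2_add_one]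
  constructor <;> ring
end

section
/- Let c > 0. Then the improper integral ∫_{c²}^{∞} (1/√(t·(t − c²)) − 1/t) dt converges and equals 2·ln 2. -/
open MeasureTheory Set

/-- For `0 < t`, `√(t(t - a))` factors as `t √(1 - a/t)`. -/
lemma sqrt_mul_sub_eq_mul_sqrt {a t : ℝ} (ht : 0 < t) :
    Real.sqrt (t * (t - a)) = t * Real.sqrt (1 - a / t) := by
  have h : t * (t - a) = t ^ 2 * (1 - a / t) := by field_simp
  rw [h, Real.sqrt_mul (sq_nonneg t), Real.sqrt_sq ht.le]

lemma hasDerivAt_two_mul_log_one_add_sqrt {a t : ℝ} (ha : 0 < a) (hat : a < t) :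
    HasDerivAt (fun t : ℝ => 2 * Real.log (1 + Real.sqrt (1 - a / t)))
      (1 / Real.sqrt (t * (t - a)) - 1 / t) t := by
  have ht : 0 < t := ha.trans hat
  have hpos : 0 < 1 - a / t := sub_pos.2 ((div_lt_one ht).2 hat)
  have hu : 0 < Real.sqrt (1 - a / t) := Real.sqrt_pos.2 hpos
  have hsq : Real.sqrt (1 - a / t) ^ 2 = 1 - a / t := Real.sq_sqrt hpos.le
  have hdiv : HasDerivAt (fun t : ℝ => 1 - a / t) (a / t ^ 2) t := by
    have h := ((hasDerivAt_inv ht.ne').const_mul a).const_sub 1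
    exact h.congr_deriv (by ring)
  have h := (((hdiv.sqrt hpos.ne').const_add 1).log (by positivity)).const_mul 2
  refine h.congr_deriv ?_
  rw [sqrt_mul_sub_eq_mul_sqrt ht]
  generalize Real.sqrt (1 - a / t) = u at hu hsq
  have ha' : a = t * (1 - u ^ 2) := by rw [hsq]; field_simp; ring
  rw [ha']
  field_simp
  ring

lemma one_div_sqrt_sub_one_div_nonneg {a t : ℝ} (ha : 0 < a) (hat : a < t) :
    0 ≤ 1 / Real.sqrt (t * (t - a)) - 1 / t := by
  have ht : 0 < t := ha.trans hat
  refine sub_nonneg.2 (one_div_le_one_div_of_le ?_ ?_)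
  · exact Real.sqrt_pos.2 (mul_pos ht (sub_pos.2 hat))
  · exact Real.sqrt_le_iff.2 ⟨ht.le, by nlinarith⟩

/-- The improper integral `∫_{c²}^{∞} (1/√(t(t − c²)) − 1/t) dt` converges and equals `2 ln 2`. -/
theorem integral_one_div_sqrt_sub_one_div (c : ℝ) (hc : 0 < c) :
    IntegrableOn (fun t : ℝ => 1 / Real.sqrt (t * (t - c ^ 2)) - 1 / t) (Ioi (c ^ 2)) ∧
    ∫ t in Ioi (c ^ 2), (1 / Real.sqrt (t * (t - c ^ 2)) - 1 / t) = 2 * Real.log 2 := by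
  have ha : 0 < c ^ 2 := pow_pos hc 2
  have hcont : ContinuousAt (fun t : ℝ => 2 * Real.log (1 + Real.sqrt (1 - c ^ 2 / t)))
      (c ^ 2) := by
    have h : ContinuousAt (fun t : ℝ => 1 + Real.sqrt (1 - c ^ 2 / t)) (c ^ 2) :=
      continuousAt_const.add
        (continuousAt_const.sub (continuousAt_const.div continuousAt_id ha.ne')).sqrt
    exact continuousAt_const.mul (h.log (by positivity))
  have hlim : Filter.Tendsto (fun t : ℝ => 2 * Real.log (1 + Real.sqrt (1 - c ^ 2 / t)))
      Filter.atTop (nhds (2 * Real.log 2)) := by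
    have h0 : Filter.Tendsto (fun t : ℝ => c ^ 2 / t) Filter.atTop (nhds 0) :=
      tendsto_const_nhds.div_atTop Filter.tendsto_id
    have h1 := ((h0.const_sub 1).sqrt.const_add 1).log (by positivity)
    have h2 := h1.const_mul 2
    rwa [sub_zero, Real.sqrt_one, one_add_one_eq_two] at h2
  have hderiv := fun t (ht : t ∈ Ioi (c ^ 2)) => hasDerivAt_two_mul_log_one_add_sqrt ha ht
  have hnonneg := fun t (ht : t ∈ Ioi (c ^ 2)) => one_div_sqrt_sub_one_div_nonneg ha ht
  refine ⟨integrableOn_Ioi_deriv_of_nonneg hcont.continuousWithinAt hderiv hnonneg hlim, ?_⟩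
  rw [integral_Ioi_of_hasDerivAt_of_nonneg hcont.continuousWithinAt hderiv hnonneg hlim]
  simp [div_self ha.ne']
end

section
/- Let 0 < b < c. Then the improper integral ∫_{c²}^{∞} dt/((t − b²)·√(t·(t − c²))) converges and equals arccos((c² − 2b²)/c²) / (b·√(c² − b²)). -/
open MeasureTheory Set

open Filter Topology

theorem two_mul_arctan_eq_arccos {x : ℝ} (hx : 0 ≤ x) :
    2 * Real.arctan x = Real.arccos ((1 - x ^ 2) / (1 + x ^ 2)) := by
  have hcos : Real.cos (2 * Real.arctan x) = (1 - x ^ 2) / (1 + x ^ 2) := by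
    have hx' : 1 + x ^ 2 ≠ 0 := by positivity
    rw [Real.cos_two_mul, Real.cos_sq_arctan]
    field_simp
    ring
  rw [← hcos, Real.arccos_cos]
  · have := Real.arctan_nonneg.2 hx
    positivity
  · linarith [Real.arctan_lt_pi_div_two x]

theorem hasDerivAt_arctan_sqrt_one_sub_div {b c k t : ℝ} (hb : 0 < b) (hk : 0 < k)
    (hbck : k ^ 2 = c ^ 2 - b ^ 2) (ht : c ^ 2 < t) :
    HasDerivAt (fun t : ℝ => 2 / (b * k) * Real.arctan (b / k * Real.sqrt (1 - c ^ 2 / t)))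
      (1 / ((t - b ^ 2) * Real.sqrt (t * (t - c ^ 2)))) t := by
  have ht0 : 0 < t := (sq_nonneg c).trans_lt ht
  have hpos : 0 < 1 - c ^ 2 / t := by rw [sub_pos, div_lt_one ht0]; exact ht
  have htb : 0 < t - b ^ 2 := by nlinarith [sq_nonneg k]
  have hsqrt : Real.sqrt (t * (t - c ^ 2)) = t * Real.sqrt (1 - c ^ 2 / t) := by
    rw [show t * (t - c ^ 2) = t ^ 2 * (1 - c ^ 2 / t) by field_simp,
      Real.sqrt_mul (sq_nonneg t), Real.sqrt_sq ht0.le]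
  have hinner : HasDerivAt (fun t : ℝ => 1 - c ^ 2 / t) (c ^ 2 / t ^ 2) t := by
    simpa [div_eq_mul_inv] using ((hasDerivAt_inv ht0.ne').const_mul (c ^ 2)).const_sub 1
  refine (((hinner.sqrt hpos.ne').const_mul (b / k)).arctan.const_mul (2 / (b * k))).congr_deriv ?_
  rw [hsqrt]
  have hu := Real.sqrt_pos.2 hpos
  have husq := Real.sq_sqrt hpos.le
  set u := Real.sqrt (1 - c ^ 2 / t)
  have hden : 1 + (b / k * u) ^ 2 = c ^ 2 * (t - b ^ 2) / (k ^ 2 * t) := by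
    rw [mul_pow, husq]
    field_simp
    rw [hbck]
    ring
  have hc : c ≠ 0 := by
    rintro rfl
    nlinarith [sq_pos_of_pos hb, sq_nonneg k]
  rw [hden]
  field_simp

/-- The improper integral `∫_{c²}^{∞} dt/((t − b²)√(t(t − c²)))` converges and equals
`arccos((c² − 2b²)/c²)/(b√(c² − b²))`. -/
theorem integral_arccos_formula (b c : ℝ) (hb : 0 < b) (hbc : b < c) :
    IntegrableOn (fun t : ℝ => 1 / ((t - b ^ 2) * Real.sqrt (t * (t - c ^ 2)))) (Ioi (c ^ 2)) ∧
    ∫ t in Ioi (c ^ 2), 1 / ((t - b ^ 2) * Real.sqrt (t * (t - c ^ 2)))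
      = Real.arccos ((c ^ 2 - 2 * b ^ 2) / c ^ 2) / (b * Real.sqrt (c ^ 2 - b ^ 2)) := by
  have hc : 0 < c := hb.trans hbc
  have hbc2 : 0 < c ^ 2 - b ^ 2 := by nlinarith
  have hk := Real.sqrt_pos.2 hbc2
  have hksq := Real.sq_sqrt hbc2.le
  set k := Real.sqrt (c ^ 2 - b ^ 2)
  have hderiv : ∀ t ∈ Ioi (c ^ 2), HasDerivAt
      (fun t : ℝ => 2 / (b * k) * Real.arctan (b / k * Real.sqrt (1 - c ^ 2 / t)))
      (1 / ((t - b ^ 2) * Real.sqrt (t * (t - c ^ 2)))) t :=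
    fun t ht => hasDerivAt_arctan_sqrt_one_sub_div hb hk hksq ht
  have hnonneg : ∀ t ∈ Ioi (c ^ 2), 0 ≤ 1 / ((t - b ^ 2) * Real.sqrt (t * (t - c ^ 2))) := by
    intro t ht
    have htb : 0 ≤ t - b ^ 2 := by linarith [mem_Ioi.1 ht]
    positivity
  have hcont : ContinuousWithinAt
      (fun t : ℝ => 2 / (b * k) * Real.arctan (b / k * Real.sqrt (1 - c ^ 2 / t)))
      (Ici (c ^ 2)) (c ^ 2) := by
    have hdiv : ContinuousAt (fun t : ℝ => c ^ 2 / t) (c ^ 2) :=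
      continuousAt_const.div continuousAt_id (by positivity)
    exact ((Real.continuous_arctan.continuousAt.comp
      ((continuousAt_const.sub hdiv).sqrt.const_mul (b / k))).const_mul _).continuousWithinAt
  have hlim : Tendsto
      (fun t : ℝ => 2 / (b * k) * Real.arctan (b / k * Real.sqrt (1 - c ^ 2 / t)))
      atTop (𝓝 (2 / (b * k) * Real.arctan (b / k))) := by
    have hdiv : Tendsto (fun t : ℝ => 1 - c ^ 2 / t) atTop (𝓝 1) := by
      simpa using (tendsto_const_nhds (x := (1 : ℝ))).sub (tendsto_id.const_div_atTop (c ^ 2))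
    have hsqrt := (hdiv.sqrt.const_mul (b / k))
    rw [Real.sqrt_one, mul_one] at hsqrt
    exact ((Real.continuous_arctan.tendsto _).comp hsqrt).const_mul _
  refine ⟨integrableOn_Ioi_deriv_of_nonneg hcont hderiv hnonneg hlim, ?_⟩
  have harg : (1 - (b / k) ^ 2) / (1 + (b / k) ^ 2) = (c ^ 2 - 2 * b ^ 2) / c ^ 2 := by
    rw [div_pow, hksq]
    field_simp
    ring
  rw [integral_Ioi_of_hasDerivAt_of_nonneg hcont hderiv hnonneg hlim, ← harg,
    ← two_mul_arctan_eq_arccos (by positivity), div_self (by positivity)]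
  simp only [sub_self, Real.sqrt_zero, mul_zero, Real.arctan_zero, sub_zero]
  ring
end

section
/- Let 0 < b < c. Then the improper integral ∫_{c²}^{∞} dt/(t·√((t − b²)·(t − c²))) converges and equals ln((c + b)/(c − b)) / (b·c). -/
open MeasureTheory Set

open Filter Topology

theorem hasDerivAt_log_sub_log_div {b c u : ℝ} (hb : b ≠ 0) (hc : c ≠ 0)
    (hadd : c + b * u ≠ 0) (hsub : c - b * u ≠ 0) :
    HasDerivAt (fun u => (Real.log (c + b * u) - Real.log (c - b * u)) / (b * c))
      (2 / ((c + b * u) * (c - b * u))) u := by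
  have h₁ : HasDerivAt (fun u => c + b * u) b u := by
    simpa using ((hasDerivAt_id u).const_mul b).const_add c
  have h₂ : HasDerivAt (fun u => c - b * u) (-b) u := by
    simpa using ((hasDerivAt_id u).const_mul b).const_sub c
  refine (((h₁.log hadd).sub (h₂.log hsub)).div_const (b * c)).congr_deriv ?_
  field_simp
  ring

theorem hasDerivAt_sqrt_div_sub {p q t : ℝ} (hpq : p < q) (ht : q < t) :
    HasDerivAt (fun t => √((t - q) / (t - p)))
      ((q - p) / (2 * (t - p) ^ 2 * √((t - q) / (t - p)))) t := by
  have hp : 0 < t - p := by linarith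
  have hquot := ((hasDerivAt_id t).sub_const q).div ((hasDerivAt_id t).sub_const p) hp.ne'
  have hpos : 0 < (t - q) / (t - p) := div_pos (by linarith) hp
  refine (hquot.sqrt hpos.ne').congr_deriv ?_
  have hs : √((t - q) / (t - p)) ≠ 0 := (Real.sqrt_pos.2 hpos).ne'
  simp only [id, Pi.div_apply]
  field_simp
  ring

theorem tendsto_sqrt_div_sub_atTop (p q : ℝ) :
    Tendsto (fun t : ℝ => √((t - q) / (t - p))) atTop (𝓝 1) := by
  have h : Tendsto (fun t : ℝ => 1 - (q - p) / (t - p)) atTop (𝓝 1) := by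
    simpa [sub_eq_add_neg] using (tendsto_const_nhds (x := (1 : ℝ))).sub
      ((tendsto_const_nhds (x := q - p)).div_atTop
        (tendsto_atTop_add_const_right atTop (-p) tendsto_id))
  have h' : Tendsto (fun t : ℝ => (t - q) / (t - p)) atTop (𝓝 1) := by
    refine h.congr' ?_
    filter_upwards [eventually_gt_atTop p] with t ht
    have : t - p ≠ 0 := (sub_pos.2 ht).ne'
    field_simp
    ring
  simpa using h'.sqrt

/-- The improper integral `∫_{c²}^{∞} dt/(t√((t − b²)(t − c²)))` converges and equals
`ln((c + b)/(c − b))/(bc)`. -/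
theorem integral_log_formula (b c : ℝ) (hb : 0 < b) (hbc : b < c) :
    IntegrableOn (fun t : ℝ => 1 / (t * Real.sqrt ((t - b ^ 2) * (t - c ^ 2)))) (Ioi (c ^ 2)) ∧
    ∫ t in Ioi (c ^ 2), 1 / (t * Real.sqrt ((t - b ^ 2) * (t - c ^ 2)))
      = Real.log ((c + b) / (c - b)) / (b * c) := by
  have hc : 0 < c := hb.trans hbc
  have hsq : b ^ 2 < c ^ 2 := by nlinarith
  let F : ℝ → ℝ := fun u => (Real.log (c + b * u) - Real.log (c - b * u)) / (b * c)
  let u : ℝ → ℝ := fun t => √((t - c ^ 2) / (t - b ^ 2))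
  have hF : ∀ v, 0 ≤ v → v ≤ 1 → HasDerivAt F (2 / ((c + b * v) * (c - b * v))) v :=
    fun v h₀ h₁ => hasDerivAt_log_sub_log_div hb.ne' hc.ne' (by positivity) (by nlinarith)
  have hu_zero : u (c ^ 2) = 0 := by simp [u]
  have hcont : ContinuousWithinAt (F ∘ u) (Ici (c ^ 2)) (c ^ 2) := by
    refine ContinuousAt.continuousWithinAt (ContinuousAt.comp ?_ ?_)
    · rw [hu_zero]
      exact (hF 0 le_rfl zero_le_one).continuousAt
    · have : c ^ 2 - b ^ 2 ≠ 0 := (sub_pos.2 hsq).ne'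
      fun_prop (disch := assumption)
  have hderiv : ∀ t ∈ Ioi (c ^ 2),
      HasDerivAt (F ∘ u) (1 / (t * √((t - b ^ 2) * (t - c ^ 2)))) t := by
    intro t ht
    have hct : 0 < t - c ^ 2 := sub_pos.2 ht
    have hbt : 0 < t - b ^ 2 := by linarith
    have ht₀ : 0 < t := by nlinarith
    have hu_pos : 0 < u t := Real.sqrt_pos.2 (div_pos hct hbt)
    have hu_sq : u t ^ 2 = (t - c ^ 2) / (t - b ^ 2) := Real.sq_sqrt (div_pos hct hbt).le
    have hu_le : u t ≤ 1 := Real.sqrt_le_one.2 ((div_le_one hbt).2 (by linarith))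
    have hsqrt : √((t - b ^ 2) * (t - c ^ 2)) = (t - b ^ 2) * u t := by
      rw [Real.sqrt_eq_iff_mul_self_eq_of_pos (by positivity)]
      field_simp at hu_sq
      linear_combination (t - b ^ 2) * hu_sq
    have hprod : (c + b * u t) * (c - b * u t) = t * (c ^ 2 - b ^ 2) / (t - b ^ 2) := by
      field_simp at hu_sq ⊢
      linear_combination -b ^ 2 * hu_sq
    refine ((hF (u t) hu_pos.le hu_le).comp t (hasDerivAt_sqrt_div_sub hsq ht)).congr_deriv ?_
    change 2 / ((c + b * u t) * (c - b * u t)) *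
      ((c ^ 2 - b ^ 2) / (2 * (t - b ^ 2) ^ 2 * u t)) = _
    rw [hsqrt, hprod]
    have : c ^ 2 - b ^ 2 ≠ 0 := (sub_pos.2 hsq).ne'
    field_simp
  have hnonneg : ∀ t ∈ Ioi (c ^ 2), 0 ≤ 1 / (t * √((t - b ^ 2) * (t - c ^ 2))) := by
    intro t ht
    have : 0 < t := (sq_nonneg c).trans_lt ht
    positivity
  have hlim : Tendsto (F ∘ u) atTop (𝓝 (F 1)) :=
    (hF 1 zero_le_one le_rfl).continuousAt.tendsto.comp (tendsto_sqrt_div_sub_atTop _ _)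
  refine ⟨integrableOn_Ioi_deriv_of_nonneg hcont hderiv hnonneg hlim, ?_⟩
  rw [integral_Ioi_of_hasDerivAt_of_nonneg hcont hderiv hnonneg hlim, Function.comp_apply, hu_zero,
    Real.log_div (by positivity) (sub_pos.2 hbc).ne']
  simp [F]
end

section
/- Let 0 < b < c be fixed. Then the function a ↦ ∫_{0}^{a²} dt/√(t·(a² − t)·(b² − t)·(c² − t)), defined for 0 < a < b, tends to π/(b·c) as a → 0⁺. -/
open MeasureTheory Set Filter

lemma hasDerivAt_arcsin_affine {m t : ℝ} (ht : t ∈ Ioo 0 m) :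
    HasDerivAt (fun t => Real.arcsin (2 / m * t - 1)) (1 / √(t * (m - t))) t := by
  obtain ⟨h0, h1⟩ := ht
  have hm : 0 < m := h0.trans h1
  have hu : 0 < 2 / m * t := by positivity
  have hu' : 2 / m * t < 2 := by
    rw [div_mul_eq_mul_div, div_lt_iff₀ hm]
    linarith
  have hinner : HasDerivAt (fun t : ℝ => 2 / m * t - 1) (2 / m) t := by
    simpa using ((hasDerivAt_id t).const_mul (2 / m)).sub_const 1
  have h := (Real.hasDerivAt_arcsin (x := 2 / m * t - 1) (by linarith) (by linarith)).comp t hinner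
  refine h.congr_deriv ?_
  have hsq : 1 - (2 / m * t - 1) ^ 2 = (2 / m) ^ 2 * (t * (m - t)) := by
    field_simp
    ring
  have hpos : 0 < t * (m - t) := mul_pos h0 (sub_pos.2 h1)
  have hs : √(t * (m - t)) ≠ 0 := (Real.sqrt_pos.2 hpos).ne'
  rw [hsq, Real.sqrt_mul (sq_nonneg _), Real.sqrt_sq (by positivity)]
  field_simp

lemma continuous_arcsin_affine (m : ℝ) :
    Continuous (fun t => Real.arcsin (2 / m * t - 1)) :=
  Real.continuous_arcsin.comp (by fun_prop)

lemma integrableOn_one_div_sqrt_mul_sub (m : ℝ) :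
    IntegrableOn (fun t => 1 / √(t * (m - t))) (Ioo 0 m) :=
  (intervalIntegral.integrableOn_deriv_of_nonneg (continuous_arcsin_affine m).continuousOn
    (fun _ ht => hasDerivAt_arcsin_affine ht) (fun _ _ => by positivity)).mono_set
    Ioo_subset_Ioc_self

lemma integral_one_div_sqrt_mul_sub {m : ℝ} (hm : 0 < m) :
    ∫ t in Ioo 0 m, 1 / √(t * (m - t)) = Real.pi := by
  have h := intervalIntegral.integral_eq_sub_of_hasDerivAt_of_le hm.le
    (continuous_arcsin_affine m).continuousOn (fun _ ht => hasDerivAt_arcsin_affine ht)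
    ((intervalIntegrable_iff_integrableOn_Ioo_of_le hm.le).2
      (integrableOn_one_div_sqrt_mul_sub m))
  rw [intervalIntegral.integral_of_le hm.le, integral_Ioc_eq_integral_Ioo] at h
  rw [h, div_mul_cancel₀ _ hm.ne']
  norm_num

lemma integral_elliptic_mem_Icc {m p q : ℝ} (hm : 0 < m) (hp : m < p) (hq : m < q) :
    ∫ t in Ioo 0 m, 1 / √(t * (m - t) * (p - t) * (q - t)) ∈
      Icc (Real.pi * (1 / √(p * q))) (Real.pi * (1 / √((p - m) * (q - m)))) := by
  have hk := integrableOn_one_div_sqrt_mul_sub m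
  have hfac : ∀ t ∈ Ioo 0 m, 1 / √(t * (m - t) * (p - t) * (q - t)) =
      1 / √(t * (m - t)) * (1 / √((p - t) * (q - t))) := by
    intro t ht
    rw [mul_assoc (t * (m - t)), Real.sqrt_mul (mul_pos ht.1 (sub_pos.2 ht.2)).le,
      one_div_mul_one_div]
  have hle : ∀ t ∈ Ioo 0 m, 1 / √(t * (m - t) * (p - t) * (q - t)) ≤
      1 / √(t * (m - t)) * (1 / √((p - m) * (q - m))) := by
    intro t ht
    rw [hfac t ht]
    have h1 : 0 < (p - m) * (q - m) := mul_pos (sub_pos.2 hp) (sub_pos.2 hq)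
    have h2 : (p - m) * (q - m) ≤ (p - t) * (q - t) := by
      apply mul_le_mul <;> linarith [ht.2]
    gcongr
  have hge : ∀ t ∈ Ioo 0 m, 1 / √(t * (m - t)) * (1 / √(p * q)) ≤
      1 / √(t * (m - t) * (p - t) * (q - t)) := by
    intro t ht
    rw [hfac t ht]
    have h1 : 0 < (p - t) * (q - t) := mul_pos (by linarith [ht.2]) (by linarith [ht.2])
    have h2 : (p - t) * (q - t) ≤ p * q := by
      apply mul_le_mul <;> linarith [ht.1, ht.2]
    gcongr
  have hf : IntegrableOn (fun t => 1 / √(t * (m - t) * (p - t) * (q - t))) (Ioo 0 m) := by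
    refine Integrable.mono' (hk.mul_const (1 / √((p - m) * (q - m)))) ?_ ?_
    · exact Measurable.aestronglyMeasurable (by fun_prop)
    · filter_upwards [ae_restrict_mem measurableSet_Ioo] with t ht
      rw [Real.norm_of_nonneg (by positivity)]
      exact hle t ht
  rw [← integral_one_div_sqrt_mul_sub hm, ← integral_mul_const, ← integral_mul_const]
  exact ⟨setIntegral_mono_on (hk.mul_const _) hf measurableSet_Ioo hge,
    setIntegral_mono_on hf (hk.mul_const _) measurableSet_Ioo hle⟩

/-- As `a → 0⁺`, the elliptic integral `∫₀^{a²} dt/√(t(a² − t)(b² − t)(c² − t))` tends to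
`π/(bc)`. -/
theorem elliptic_integral_limit_a_to_zero (b c : ℝ) (hb : 0 < b) (hbc : b < c) :
    Tendsto (fun a : ℝ =>
        ∫ t in Ioo (0 : ℝ) (a ^ 2),
          1 / Real.sqrt (t * (a ^ 2 - t) * (b ^ 2 - t) * (c ^ 2 - t)))
      (nhdsWithin 0 (Ioi 0)) (nhds (Real.pi / (b * c))) := by
  have hc : 0 < c := hb.trans hbc
  have hlim : √(b ^ 2 * c ^ 2) = b * c := by
    rw [← mul_pow, Real.sqrt_sq (by positivity)]
  have hupper : Tendsto (fun a : ℝ => Real.pi * (1 / √((b ^ 2 - a ^ 2) * (c ^ 2 - a ^ 2))))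
      (nhdsWithin 0 (Ioi 0)) (nhds (Real.pi / (b * c))) := by
    have hcont : ContinuousAt
        (fun a : ℝ => Real.pi * (1 / √((b ^ 2 - a ^ 2) * (c ^ 2 - a ^ 2)))) 0 := by
      refine continuousAt_const.mul (continuousAt_const.div (by fun_prop) ?_)
      norm_num [hlim, hb.ne', hc.ne']
    have h := hcont.tendsto
    rw [zero_pow two_ne_zero, sub_zero, sub_zero, hlim, mul_one_div] at h
    exact h.mono_left nhdsWithin_le_nhds
  have hbounds : ∀ᶠ a : ℝ in nhdsWithin 0 (Ioi 0),
      ∫ t in Ioo (0 : ℝ) (a ^ 2), 1 / √(t * (a ^ 2 - t) * (b ^ 2 - t) * (c ^ 2 - t)) ∈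
        Icc (Real.pi * (1 / √(b ^ 2 * c ^ 2)))
          (Real.pi * (1 / √((b ^ 2 - a ^ 2) * (c ^ 2 - a ^ 2)))) := by
    filter_upwards [Ioo_mem_nhdsGT hb] with a ha
    have hab : a ^ 2 < b ^ 2 := pow_lt_pow_left₀ ha.2 ha.1.le two_ne_zero
    exact integral_elliptic_mem_Icc (pow_pos ha.1 2) hab
      (hab.trans (pow_lt_pow_left₀ hbc hb.le two_ne_zero))
  rw [hlim, mul_one_div] at hbounds
  exact tendsto_of_tendsto_of_tendsto_of_le_of_le' tendsto_const_nhds hupper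
    (hbounds.mono fun _ h => h.1) (hbounds.mono fun _ h => h.2)
end

section
/- Let 0 < b < c be fixed. Then the function a ↦ ∫_{a²}^{b²} dt/√((t − a²)·(b² − t)·(c² − t)), defined for 0 < a < b, tends to π/√(c² − b²) as a → b⁻. -/
open MeasureTheory Set Filter

/-- The substitution `t = m - r cos θ` maps `(0, π)` onto `(m - r, m + r)`. -/
lemma image_sub_mul_cos_Ioo {m r : ℝ} (hr : 0 < r) :
    (fun θ : ℝ => m - r * Real.cos θ) '' Ioo 0 Real.pi = Ioo (m - r) (m + r) := by
  ext t
  constructor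
  · rintro ⟨θ, ⟨h0, hpi⟩, rfl⟩
    have h1 : Real.cos θ < 1 := by
      simpa using Real.cos_lt_cos_of_nonneg_of_le_pi le_rfl hpi.le h0
    have h2 : -1 < Real.cos θ := by
      simpa using Real.cos_lt_cos_of_nonneg_of_le_pi h0.le le_rfl hpi
    constructor <;> dsimp only <;> nlinarith
  · rintro ⟨h1, h2⟩
    have h3 : (m - t) / r < 1 := by rw [div_lt_one hr]; linarith
    have h4 : -1 < (m - t) / r := by rw [lt_div_iff₀ hr]; linarith
    refine ⟨Real.arccos ((m - t) / r), ⟨Real.arccos_pos.2 h3, ?_⟩, ?_⟩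
    · exact lt_of_le_of_ne (Real.arccos_le_pi _) fun h => by
        linarith [Real.arccos_eq_pi.1 h]
    · dsimp only
      rw [Real.cos_arccos h4.le h3.le]
      field_simp
      ring

/-- Trigonometric form of the integral of `1 / √((t - p) (q - t) (s - t))` over `(p, q)`. -/
lemma setIntegral_one_div_sqrt_eq_integral_cos {p q : ℝ} (hpq : p < q) (s : ℝ) :
    ∫ t in Ioo p q, 1 / Real.sqrt ((t - p) * (q - t) * (s - t)) =
      ∫ θ in Ioo 0 Real.pi,
        1 / Real.sqrt (s - ((p + q) / 2 - (q - p) / 2 * Real.cos θ)) := by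
  have hr : 0 < (q - p) / 2 := by linarith
  have himage := image_sub_mul_cos_Ioo (m := (p + q) / 2) hr
  rw [show (p + q) / 2 - (q - p) / 2 = p by ring,
    show (p + q) / 2 + (q - p) / 2 = q by ring] at himage
  rw [← himage, integral_image_eq_integral_abs_deriv_smul measurableSet_Ioo
    (f' := fun θ => (q - p) / 2 * Real.sin θ)]
  · refine setIntegral_congr_fun measurableSet_Ioo fun θ hθ => ?_
    have hpos : 0 < (q - p) / 2 * Real.sin θ := mul_pos hr (Real.sin_pos_of_mem_Ioo hθ)
    have hsq : ((p + q) / 2 - (q - p) / 2 * Real.cos θ - p) *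
        (q - ((p + q) / 2 - (q - p) / 2 * Real.cos θ)) = ((q - p) / 2 * Real.sin θ) ^ 2 := by
      rw [mul_pow, Real.sin_sq]
      ring
    rw [hsq, Real.sqrt_mul (sq_nonneg _), Real.sqrt_sq hpos.le, abs_of_pos hpos, smul_eq_mul,
      mul_one_div, div_mul_cancel_left₀ hpos.ne', one_div]
  · intro θ _
    have h := ((Real.hasDerivAt_cos θ).const_mul ((q - p) / 2)).const_sub ((p + q) / 2)
    exact (h.congr_deriv (by ring)).hasDerivWithinAt
  · intro x hx y hy hxy
    refine Real.injOn_cos (Ioo_subset_Icc_self hx) (Ioo_subset_Icc_self hy) ?_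
    exact mul_left_cancel₀ hr.ne' (sub_right_injective hxy)

/-- As `a → b⁻`, the elliptic integral `∫_{a²}^{b²} dt/√((t − a²)(b² − t)(c² − t))` tends to
`π/√(c² − b²)`. -/
theorem elliptic_integral_limit_a_to_b (b c : ℝ) (hb : 0 < b) (hbc : b < c) :
    Tendsto (fun a : ℝ =>
        ∫ t in Ioo (a ^ 2) (b ^ 2),
          1 / Real.sqrt ((t - a ^ 2) * (b ^ 2 - t) * (c ^ 2 - t)))
      (nhdsWithin b (Iio b)) (nhds (Real.pi / Real.sqrt (c ^ 2 - b ^ 2))) := by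
  have hcb : 0 < c ^ 2 - b ^ 2 := by nlinarith
  have hlt : ∀ᶠ a in nhdsWithin b (Iio b), a ^ 2 < b ^ 2 := by
    filter_upwards [Ioo_mem_nhdsLT hb] with a ha
    exact pow_lt_pow_left₀ ha.2 ha.1.le two_ne_zero
  have hlim : Real.pi / Real.sqrt (c ^ 2 - b ^ 2) =
      ∫ _ in Ioo 0 Real.pi, 1 / Real.sqrt (c ^ 2 - b ^ 2) := by
    simp [Real.pi_pos.le, div_eq_mul_inv]
  rw [hlim]
  refine Tendsto.congr' (hlt.mono fun a ha =>
    (setIntegral_one_div_sqrt_eq_integral_cos ha (c ^ 2)).symm) ?_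
  refine tendsto_integral_filter_of_dominated_convergence
    (fun _ => 1 / Real.sqrt (c ^ 2 - b ^ 2)) ?_ ?_ ?_ ?_
  · exact Eventually.of_forall fun a => Measurable.aestronglyMeasurable (by fun_prop)
  · filter_upwards [hlt] with a ha
    refine Eventually.of_forall fun θ => ?_
    rw [Real.norm_of_nonneg (by positivity)]
    refine one_div_le_one_div_of_le (Real.sqrt_pos.2 hcb) (Real.sqrt_le_sqrt ?_)
    nlinarith [Real.neg_one_le_cos θ]
  · exact integrable_const _
  · refine Eventually.of_forall fun θ => tendsto_nhdsWithin_of_tendsto_nhds ?_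
    have hval : c ^ 2 - ((b ^ 2 + b ^ 2) / 2 - (b ^ 2 - b ^ 2) / 2 * Real.cos θ) =
        c ^ 2 - b ^ 2 := by ring
    have hcont : ContinuousAt (fun a : ℝ => 1 / Real.sqrt
        (c ^ 2 - ((a ^ 2 + b ^ 2) / 2 - (b ^ 2 - a ^ 2) / 2 * Real.cos θ))) b := by
      refine continuousAt_const.div (by fun_prop) ?_
      rw [hval]
      exact (Real.sqrt_pos.2 hcb).ne'
    simpa only [hval] using hcont.tendsto
end
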